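/- arXiv:2304.08684 — 6 statements merged into one kernel-verified Lean document; each statement's English description precedes it below -/
import Mathlib

section
/- Let E be a real normed vector space, C a subset of E, and let x : ℝ → E satisfy, for every t in the interval [t₀, t₁], that x is differentiable at t with derivative F(x(t)) + d(t), where F : E → E, d : ℝ → E, and x(t) ∈ C for all t ∈ [t₀, t₁]. Assume ‖F(y)‖ ≤ B for all y ∈ C, ‖d(t)‖ ≤ d̄ for all t ∈ [t₀, t₁], and let Ξ : E → ℝ be Lipschitz with constant L ≥ 0. If Ξ(x(t₀)) ≥ c, then for every t ∈ [t₀, t₁] one has Ξ(x(t)) ≥ c − L·(B + d̄)·(t − t₀). -/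
/-- Key decay estimate in Proposition 1: along the flow `ẋ = F(x) + d` with
`‖F‖ ≤ B` on `C` and `‖d‖ ≤ d̄`, a Lipschitz trigger condition `Ξ` with
constant `L` satisfies `Ξ(x(t)) ≥ c - L·(B + d̄)·(t - t₀)` whenever
`Ξ(x(t₀)) ≥ c`. -/
theorem trigger_decay_estimate
    {E : Type*} [NormedAddCommGroup E] [NormedSpace ℝ E]
    (C : Set E) (x : ℝ → E) (F : E → E) (d : ℝ → E)
    (t₀ t₁ B dbar c : ℝ)
    (hx : ∀ t ∈ Set.Icc t₀ t₁, HasDerivAt x (F (x t) + d t) t)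
    (hxC : ∀ t ∈ Set.Icc t₀ t₁, x t ∈ C)
    (hF : ∀ y ∈ C, ‖F y‖ ≤ B)
    (hd : ∀ t ∈ Set.Icc t₀ t₁, ‖d t‖ ≤ dbar)
    (Ξ : E → ℝ) (L : NNReal) (hΞ : LipschitzWith L Ξ)
    (h0 : c ≤ Ξ (x t₀)) :
    ∀ t ∈ Set.Icc t₀ t₁, c - (L : ℝ) * (B + dbar) * (t - t₀) ≤ Ξ (x t) := by
  intro t ht
  have h_disp : ‖x t - x t₀‖ ≤ (B + dbar) * (t - t₀) :=
    norm_image_sub_le_of_norm_deriv_le_segment'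
      (fun s hs => (hx s hs).hasDerivWithinAt)
      (fun s hs => norm_add_le_of_le (hF _ (hxC s (Set.Ico_subset_Icc_self hs)))
        (hd s (Set.Ico_subset_Icc_self hs))) t ht
  have h_lip : |Ξ (x t) - Ξ (x t₀)| ≤ L * ‖x t - x t₀‖ := by
    simpa only [dist_eq_norm, Real.norm_eq_abs] using hΞ.dist_le_mul (x t) (x t₀)
  have h_bound := h_lip.trans (mul_le_mul_of_nonneg_left h_disp L.coe_nonneg)
  linarith [(abs_le.mp h_bound).1]
end

section
/- Let E be a real normed vector space, C a subset of E, and let x : ℝ → E satisfy, for every t in the interval [t₀, t₁], that x is differentiable at t with derivative F(x(t)) + d(t), where x(t) ∈ C, ‖F(y)‖ ≤ B for all y ∈ C, and ‖d(t)‖ ≤ d̄. Let Ξ : E → ℝ be Lipschitz with constant L, assume c > 0, L·(B + d̄) > 0, and Ξ(x(t₀)) ≥ c. Then any time t* ∈ [t₀, t₁] at which Ξ(x(t*)) ≤ 0 satisfies t* − t₀ ≥ c / (L·(B + d̄)); in particular the next event triggered by the condition Ξ(x(t)) ≤ 0 cannot occur before time t₀ + c/(L·(B + d̄)). -/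
/-- Minimum inter-event time bound from Proposition 1: if `Ξ(x(t₀)) ≥ c > 0`
and the flow is `ẋ = F(x) + d` with `‖F‖ ≤ B` on `C` and `‖d‖ ≤ d̄`, then any
time `t* ∈ [t₀, t₁]` at which `Ξ(x(t*)) ≤ 0` satisfies
`t* - t₀ ≥ c / (L·(B + d̄))`. -/
theorem minimum_inter_event_time
    {E : Type*} [NormedAddCommGroup E] [NormedSpace ℝ E]
    (C : Set E) (x : ℝ → E) (F : E → E) (d : ℝ → E)
    (t₀ t₁ B dbar c : ℝ)
    (hx : ∀ t ∈ Set.Icc t₀ t₁, HasDerivAt x (F (x t) + d t) t)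
    (hxC : ∀ t ∈ Set.Icc t₀ t₁, x t ∈ C)
    (hF : ∀ y ∈ C, ‖F y‖ ≤ B)
    (hd : ∀ t ∈ Set.Icc t₀ t₁, ‖d t‖ ≤ dbar)
    (Ξ : E → ℝ) (L : NNReal) (hΞ : LipschitzWith L Ξ)
    (hc : 0 < c) (hLBd : 0 < (L : ℝ) * (B + dbar))
    (h0 : c ≤ Ξ (x t₀)) :
    ∀ tstar ∈ Set.Icc t₀ t₁, Ξ (x tstar) ≤ 0 →
      c / ((L : ℝ) * (B + dbar)) ≤ tstar - t₀ := by
  intro tstar ht hle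
  have hspeed : ∀ t ∈ Set.Icc t₀ t₁, ‖F (x t) + d t‖ ≤ B + dbar := fun t ht =>
    (norm_add_le _ _).trans (add_le_add (hF _ (hxC t ht)) (hd t ht))
  have hmove : ‖x tstar - x t₀‖ ≤ (B + dbar) * ‖tstar - t₀‖ :=
    (convex_Icc t₀ t₁).norm_image_sub_le_of_norm_hasDerivWithin_le
      (fun t ht => (hx t ht).hasDerivWithinAt) hspeed
      (Set.left_mem_Icc.2 (ht.1.trans ht.2)) ht
  rw [Real.norm_of_nonneg (sub_nonneg.2 ht.1)] at hmove
  have hlip := hΞ.dist_le_mul (x tstar) (x t₀)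
  rw [Real.dist_eq, dist_eq_norm] at hlip
  have hdrop := (neg_le_abs (Ξ (x tstar) - Ξ (x t₀))).trans
    (hlip.trans (mul_le_mul_of_nonneg_left hmove L.coe_nonneg))
  rw [div_le_iff₀ hLBd]
  linarith
end

section
/- Let α : ℝ → ℝ be strictly monotone increasing with α(0) = 0. Let g : ℝ → ℝ be differentiable at every t in the interval [t₀, t₁] with g'(t) ≥ −α(g(t)) for all t ∈ [t₀, t₁]. If g(t₀) ≥ 0, then g(t) ≥ 0 for all t ∈ [t₀, t₁]. -/
/-- Scalar barrier comparison lemma: if `g` satisfies `g' ≥ -α(g)` on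
`[t₀, t₁]` with a class-K function `α` (strictly increasing, `α(0) = 0`) and
`g(t₀) ≥ 0`, then `g` remains nonnegative on `[t₀, t₁]`. -/
theorem barrier_comparison
    (α : ℝ → ℝ) (hα : StrictMono α) (hα0 : α 0 = 0)
    (t₀ t₁ : ℝ) (g g' : ℝ → ℝ)
    (hderiv : ∀ t ∈ Set.Icc t₀ t₁, HasDerivAt g (g' t) t)
    (hineq : ∀ t ∈ Set.Icc t₀ t₁, -α (g t) ≤ g' t)
    (h0 : 0 ≤ g t₀) :
    ∀ t ∈ Set.Icc t₀ t₁, 0 ≤ g t := by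
  intro t ht
  refine le_of_forall_pos_le_add fun ε hε => ?_
  have h : -g t ≤ ε := by
    refine image_le_of_deriv_right_lt_deriv_boundary (f := fun x => -g x) (f' := fun x => -g' x)
      (B := fun _ => ε) (B' := fun _ => 0)
      (fun x hx => (hderiv x hx).continuousAt.neg.continuousWithinAt)
      (fun x hx => (hderiv x (Set.Ico_subset_Icc_self hx)).neg.hasDerivWithinAt)
      (by linarith) (fun x => hasDerivAt_const x ε) (fun x hx hgx => ?_) ht
    have hα_neg : α (g x) < 0 := hα0 ▸ hα (show g x < 0 by linarith)
    linarith [hineq x (Set.Ico_subset_Icc_self hx)]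
  linarith
end

section
/- Let α : ℝ → ℝ be strictly monotone increasing with α(0) = 0. Let t : ℕ → ℝ be a strictly increasing sequence of event times tending to infinity, and let g : ℝ → ℝ be such that for every i ∈ ℕ: (a) g is continuous on the half-open interval [t(i), t(i+1)); (b) g is differentiable at every s in the open interval (t(i), t(i+1)) with g'(s) ≥ −α(g(s)); and (c) g(t(i)) ≥ 0. Then g(t) ≥ 0 for all t ≥ t(0). -/
/-- A function that starts nonnegative and has nonnegative derivative wherever it is negative
stays nonnegative. -/
theorem nonneg_of_deriv_nonneg_of_neg {g : ℝ → ℝ} {a b : ℝ} (hab : a ≤ b)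
    (hcont : ContinuousOn g (Set.Icc a b)) (hdiff : DifferentiableOn ℝ g (Set.Ioo a b))
    (hderiv : ∀ r ∈ Set.Ioo a b, g r < 0 → 0 ≤ deriv g r) (ha : 0 ≤ g a) :
    0 ≤ g b := by
  have hcompact : IsCompact (Set.Icc a b ∩ g ⁻¹' Set.Ici 0) :=
    isCompact_Icc.of_isClosed_subset (hcont.preimage_isClosed_of_isClosed isClosed_Icc isClosed_Ici)
      Set.inter_subset_left
  obtain ⟨u, ⟨⟨hau, hub⟩, hgu⟩, hmax⟩ :=
    hcompact.exists_isGreatest ⟨a, Set.left_mem_Icc.2 hab, ha⟩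
  have hneg : ∀ r ∈ Set.Ioo u b, g r < 0 := by
    intro r hr
    by_contra! h
    exact hr.1.not_ge (hmax ⟨⟨hau.trans hr.1.le, hr.2.le⟩, h⟩)
  have hmono : MonotoneOn g (Set.Icc u b) := by
    refine monotoneOn_of_deriv_nonneg (convex_Icc u b)
      (hcont.mono (Set.Icc_subset_Icc_left hau)) ?_ ?_ <;> rw [interior_Icc]
    · exact hdiff.mono (Set.Ioo_subset_Ioo_left hau)
    · exact fun r hr ↦ hderiv r (Set.Ioo_subset_Ioo_left hau hr) (hneg r hr)
  exact le_trans hgu (hmono (Set.left_mem_Icc.2 hub) (Set.right_mem_Icc.2 hub) hub)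

/-- Safety conclusion of Propositions 1 and 2 for impulsive systems: the
barrier value `g(t) = h(x(t))` along a hybrid trajectory with jump times
`t(i)` (strictly increasing, tending to infinity) is continuous on each
`[t(i), t(i+1))`, satisfies `g' ≥ -α(g)` on each `(t(i), t(i+1))`, and is
nonnegative at each jump time; hence it is nonnegative for all `t ≥ t(0)`. -/
theorem impulsive_safety
    (α : ℝ → ℝ) (hα : StrictMono α) (hα0 : α 0 = 0)
    (t : ℕ → ℝ) (ht : StrictMono t)
    (htop : Filter.Tendsto t Filter.atTop Filter.atTop)
    (g : ℝ → ℝ)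
    (hcont : ∀ i : ℕ, ContinuousOn g (Set.Ico (t i) (t (i + 1))))
    (hderiv : ∀ i : ℕ, ∀ s ∈ Set.Ioo (t i) (t (i + 1)),
      ∃ g's : ℝ, HasDerivAt g g's s ∧ -α (g s) ≤ g's)
    (hjump : ∀ i : ℕ, 0 ≤ g (t i)) :
    ∀ s : ℝ, t 0 ≤ s → 0 ≤ g s := by
  intro s hs
  obtain ⟨i, his, hsi⟩ : ∃ i, s ∈ Set.Ico (t i) (t (i + 1)) :=
    Set.mem_iUnion.1 <| (iUnion_Ico_map_succ_eq_Ici (fun i ↦ ht.monotone (Nat.zero_le i))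
      (Filter.not_bddAbove_of_tendsto_atTop htop)).ge hs
  have hsub : Set.Ioo (t i) s ⊆ Set.Ioo (t i) (t (i + 1)) := Set.Ioo_subset_Ioo_right hsi.le
  refine nonneg_of_deriv_nonneg_of_neg his ((hcont i).mono (Set.Icc_subset_Ico_right hsi))
    (fun r hr ↦ ?_) (fun r hr hneg ↦ ?_) (hjump i)
  · obtain ⟨g', hg', -⟩ := hderiv i r (hsub hr)
    exact hg'.differentiableAt.differentiableWithinAt
  · obtain ⟨g', hg', hle⟩ := hderiv i r (hsub hr)
    rw [hg'.deriv]
    linarith [hα hneg]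
end

section
/- Let E be a real normed vector space, C a subset of E, F_nom : E → E with ‖F_nom(y)‖ ≤ B for all y ∈ C, and let x : ℝ → E satisfy, for every t ∈ [t_off, t₁], that x is differentiable at t with derivative F_nom(x(t)) + d(t), with x(t) ∈ C and ‖d(t)‖ ≤ d̄. Let Ξ_on : E → ℝ be Lipschitz with constant L, with c > 0 and L·(B + d̄) > 0, and suppose Ξ_on(x(t_off)) ≥ c. Then every time t* ∈ [t_off, t₁] with Ξ_on(x(t*)) ≤ 0 satisfies t* − t_off ≥ c/(L·(B + d̄)); that is, the filter remains off for a duration of at least τ = c/(L·(B + d̄)). -/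
/-- Second claim of Theorem 1: after switching the filter off at `t_off` with
margin `Ξ_on(x(t_off)) ≥ c`, the nominal flow `ẋ = F_nom(x) + d` (with
`‖F_nom‖ ≤ B` on `C` and `‖d‖ ≤ d̄`) cannot reach `Ξ_on(x(t*)) ≤ 0` before a
duration `τ = c/(L·(B + d̄))` has elapsed. -/
theorem filter_off_minimum_duration
    {E : Type*} [NormedAddCommGroup E] [NormedSpace ℝ E]
    (C : Set E) (Fnom : E → E) (x : ℝ → E) (d : ℝ → E)
    (toff t₁ B dbar c : ℝ)
    (hF : ∀ y ∈ C, ‖Fnom y‖ ≤ B)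
    (hx : ∀ t ∈ Set.Icc toff t₁, HasDerivAt x (Fnom (x t) + d t) t)
    (hxC : ∀ t ∈ Set.Icc toff t₁, x t ∈ C)
    (hd : ∀ t ∈ Set.Icc toff t₁, ‖d t‖ ≤ dbar)
    (Ξon : E → ℝ) (L : NNReal) (hΞ : LipschitzWith L Ξon)
    (hc : 0 < c) (hLBd : 0 < (L : ℝ) * (B + dbar))
    (h0 : c ≤ Ξon (x toff)) :
    ∀ tstar ∈ Set.Icc toff t₁, Ξon (x tstar) ≤ 0 →
      c / ((L : ℝ) * (B + dbar)) ≤ tstar - toff := by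
  intro tstar ht hle
  have hspeed : ‖x tstar - x toff‖ ≤ (B + dbar) * ‖tstar - toff‖ :=
    (convex_Icc toff t₁).norm_image_sub_le_of_norm_hasDerivWithin_le
      (fun t hmem => (hx t hmem).hasDerivWithinAt)
      (fun t hmem => (norm_add_le _ _).trans (add_le_add (hF _ (hxC t hmem)) (hd t hmem)))
      (Set.left_mem_Icc.2 (ht.1.trans ht.2)) ht
  rw [Real.norm_of_nonneg (sub_nonneg.2 ht.1)] at hspeed
  have hdist := hΞ.dist_le_mul (x tstar) (x toff)
  rw [Real.dist_eq, dist_eq_norm] at hdist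
  rw [div_le_iff₀ hLBd]
  calc c ≤ |Ξon (x tstar) - Ξon (x toff)| := by
        rw [abs_sub_comm]
        exact (by linarith : c ≤ Ξon (x toff) - Ξon (x tstar)).trans (le_abs_self _)
    _ ≤ L * ‖x tstar - x toff‖ := hdist
    _ ≤ L * ((B + dbar) * (tstar - toff)) := by gcongr
    _ = (tstar - toff) * (L * (B + dbar)) := by ring
end

section
/- Let α : ℝ → ℝ be strictly monotone increasing with α(0) = 0, and let b > 0. Let g : ℝ → ℝ be differentiable at every t ∈ [0, T], and assume that for each t ∈ [0, T], at least one of the following holds: g'(t) ≥ b, or g'(t) ≥ −α(g(t)). If g(0) ≥ 0, then g(t) ≥ 0 for all t ∈ [0, T]. -/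
/-- Safety conclusion of Theorem 1 for the intermittent system: at each time
either the filter is on (`g' ≥ b > 0`) or the trigger maintains the barrier
condition (`g' ≥ -α(g)` with class-K `α`); starting nonnegative, the barrier
value stays nonnegative on `[0, T]`. -/
theorem intermittent_safety
    (α : ℝ → ℝ) (hα : StrictMono α) (hα0 : α 0 = 0)
    (b : ℝ) (hb : 0 < b) (T : ℝ) (g g' : ℝ → ℝ)
    (hderiv : ∀ t ∈ Set.Icc (0 : ℝ) T, HasDerivAt g (g' t) t)
    (hcase : ∀ t ∈ Set.Icc (0 : ℝ) T, b ≤ g' t ∨ -α (g t) ≤ g' t)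
    (h0 : 0 ≤ g 0) :
    ∀ t ∈ Set.Icc (0 : ℝ) T, 0 ≤ g t := by
  intro t ht
  by_contra! hneg
  have hsub : Set.Icc 0 t ⊆ Set.Icc 0 T := Set.Icc_subset_Icc_right ht.2
  obtain ⟨c, hc, hmin⟩ := isCompact_Icc.exists_isMinOn (Set.nonempty_Icc.mpr ht.1)
    (fun x hx => (hderiv x (hsub hx)).continuousAt.continuousWithinAt : ContinuousOn g (Set.Icc 0 t))
  have hgc : g c < 0 := (hmin (Set.right_mem_Icc.mpr ht.1)).trans_lt hneg
  have hc0 : 0 < c := hc.1.lt_of_ne (by rintro rfl; exact absurd h0 hgc.not_ge)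
  have hpos : 0 < g' c := by
    have hαc : α (g c) < 0 := hα0 ▸ hα hgc
    rcases hcase c (hsub hc) with h | h <;> linarith
  have hslope : ∀ᶠ x in nhdsWithin c (Set.Iio c), 0 < slope g c x :=
    ((hasDerivAt_iff_tendsto_slope.mp (hderiv c (hsub hc))).mono_left
      (nhdsWithin_mono c fun x hx => ne_of_lt hx)).eventually (lt_mem_nhds hpos)
  obtain ⟨x, hx, hxc⟩ := (hslope.and (Ioo_mem_nhdsLT hc0)).exists
  have hle : g c ≤ g x := hmin ⟨hxc.1.le, hxc.2.le.trans hc.2⟩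
  rw [slope_def_field] at hx
  exact hx.not_ge (div_nonpos_of_nonneg_of_nonpos (sub_nonneg.mpr hle) (sub_nonpos.mpr hxc.2.le))
end
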